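/- arXiv:1402.6085 — 4 statements merged into one kernel-verified Lean document; each statement's English description precedes it below -/
import Mathlib

section
/- For any two vertices x and y of Q, there is at most one path from x to y all of whose arrows belong to {f_1, …, f_l}. -/
/-- Paths in a quiver given by source and target maps `s t : E → P`.
`QPath s t x y` is the type of paths from `x` to `y`. -/
inductive QPath {P E : Type} (s t : E → P) : P → P → Type
  | nil (x : P) : QPath s t x x
  | cons {x : P} (e : E) (p : QPath s t x (s e)) : QPath s t x (t e)

namespace QPath

variable {P E : Type} {s t : E → P}

/-- Concatenation of paths. -/
def comp : ∀ {x y z : P}, QPath s t x y → QPath s t y z → QPath s t x z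
  | _, _, _, p, .nil _ => p
  | _, _, _, p, .cons e q => .cons e (comp p q)

/-- The length-one path given by a single arrow. -/
def single (e : E) : QPath s t (s e) (t e) := .cons e (.nil (s e))

/-- The length of a path. -/
def length : ∀ {x y : P}, QPath s t x y → ℕ
  | _, _, .nil _ => 0
  | _, _, .cons _ p => length p + 1

/-- The list of arrows occurring in a path. -/
def arrows : ∀ {x y : P}, QPath s t x y → List E
  | _, _, .nil _ => []
  | _, _, .cons e p => e :: arrows p

end QPath

section BW

variable (k : Type) [Field k] {P E : Type} (s t : E → P)
  (D : P → Type) [∀ x, AddCommGroup (D x)] [∀ x, Module k (D x)]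
  (De : ∀ e : E, D (s e) →ₗ[k] D (t e))

/-- The value of a functor (given on vertices by `D` and on arrows by `De`)
on a path, i.e. the composite of the linear maps along the path. -/
def pathMap : ∀ {x y : P}, QPath s t x y → (D x →ₗ[k] D y)
  | _, _, .nil _ => LinearMap.id
  | _, _, .cons e p => (De e).comp (pathMap p)

/-- `d` is a derivation with coefficients in the natural system `D̂ ∘ t`:
`d (q ∘ p) = D̂(q) (d p) + d q`. -/
def IsDerivation (d : ∀ x y : P, QPath s t x y → D y) : Prop :=
  ∀ (x y z : P) (p : QPath s t x y) (q : QPath s t y z),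
    d x z (p.comp q) = pathMap k s t D De q (d x y p) + d y z q

/-- The space of derivations. -/
def Der : Submodule k (∀ x y : P, QPath s t x y → D y) where
  carrier := {d | IsDerivation k s t D De d}
  add_mem' := by
    intro a b ha hb x y z p q
    simp only [Pi.add_apply, ha x y z p q, hb x y z p q, map_add]
    abel
  zero_mem' := by
    intro x y z p q
    simp
  smul_mem' := by
    intro c a ha x y z p q
    simp only [Pi.smul_apply, ha x y z p q, map_smul, smul_add]

/-- The space of inner derivations. -/
def Ider : Submodule k (∀ x y : P, QPath s t x y → D y) where
  carrier := {d | ∃ nn : ∀ x : P, D x, ∀ (x y : P) (p : QPath s t x y),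
    d x y p = pathMap k s t D De p (nn x) - nn y}
  add_mem' := by
    rintro a b ⟨na, hna⟩ ⟨nb, hnb⟩
    refine ⟨na + nb, fun x y p => ?_⟩
    simp only [Pi.add_apply, hna x y p, hnb x y p, map_add]
    abel
  zero_mem' := ⟨0, fun x y p => by simp⟩
  smul_mem' := by
    rintro c a ⟨na, hna⟩
    refine ⟨c • na, fun x y p => ?_⟩
    simp only [Pi.smul_apply, hna x y p, map_smul, smul_sub]

/-- Inner derivations, as a submodule of the space of derivations. -/
def IderInDer : Submodule k ↥(Der k s t D De) :=
  (Ider k s t D De).comap (Der k s t D De).subtype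

/-- The first Baues–Wirsching cohomology `Der/IDer`. -/
abbrev BW1 := ↥(Der k s t D De) ⧸ IderInDer k s t D De

/-- The restriction map `ρ` sending a derivation to its values on the arrows. -/
def restrict : ↥(Der k s t D De) →ₗ[k] (∀ e : E, D (t e)) where
  toFun d := fun e => (d : ∀ x y : P, QPath s t x y → D y) (s e) (t e) (QPath.single e)
  map_add' a b := rfl
  map_smul' c a := rfl

end BW

namespace QPath

variable {P E : Type} {s t : E → P} {l : ℕ} {a : Fin l → P} {f : Fin l → E}

/-- A path of selected arrows starting at `a j` ends at some `a i` with `i ≤ j`. -/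
theorem exists_le_end_eq (hft : ∀ i, t (f i) = a i)
    (hfs : ∀ i j : Fin l, s (f i) = a j → (i : ℕ) < (j : ℕ))
    {x y : P} (p : QPath s t x y) (hp : ∀ e ∈ p.arrows, ∃ i, f i = e)
    {j : Fin l} (hx : x = a j) : ∃ i ≤ j, y = a i := by
  induction p with
  | nil => exact ⟨j, le_rfl, hx⟩
  | cons e p ih =>
    obtain ⟨k, rfl⟩ := hp e (by simp [arrows])
    obtain ⟨i, hij, hi⟩ := ih (fun e he => hp e (by simp [arrows, he]))
    exact ⟨k, (Fin.lt_def.2 (hfs k i hi)).le.trans hij, hft k⟩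

/-- A nonempty path of selected arrows is not closed. -/
theorem target_ne_start (hft : ∀ i, t (f i) = a i)
    (hfs : ∀ i j : Fin l, s (f i) = a j → (i : ℕ) < (j : ℕ))
    {x : P} {e : E} (p : QPath s t x (s e))
    (hp : ∀ e' ∈ (cons e p).arrows, ∃ i, f i = e') : t e ≠ x := by
  intro hx
  obtain ⟨k, rfl⟩ := hp e (by simp [arrows])
  obtain ⟨i, hik, hi⟩ := exists_le_end_eq hft hfs p
    (fun e he => hp e (by simp [arrows, he])) (hx.symm.trans (hft k))
  exact (Fin.lt_def.2 (hfs k i hi)).not_ge hik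

/-- Paths of selected arrows with the same start and end agree, provided the targets of the
selected arrows are distinct. The end points are only propositionally equal. -/
theorem heq_of_end_eq (ha : Function.Injective a) (hft : ∀ i, t (f i) = a i)
    (hfs : ∀ i j : Fin l, s (f i) = a j → (i : ℕ) < (j : ℕ))
    {x y z : P} (p : QPath s t x y) (q : QPath s t x z)
    (hp : ∀ e ∈ p.arrows, ∃ i, f i = e) (hq : ∀ e ∈ q.arrows, ∃ i, f i = e)
    (hyz : y = z) : HEq p q := by
  induction p generalizing z with
  | nil =>
    cases q with
    | nil => rfl
    | cons e q => exact absurd hyz.symm (target_ne_start hft hfs q hq)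
  | cons e p ih =>
    cases q with
    | nil => exact absurd hyz (target_ne_start hft hfs p hp)
    | cons e' q =>
      obtain ⟨i, rfl⟩ := hp e (by simp [arrows])
      obtain ⟨j, rfl⟩ := hq e' (by simp [arrows])
      obtain rfl : i = j := ha (by rw [← hft i, ← hft j, hyz])
      rw [eq_of_heq (ih q (fun e he => hp e (by simp [arrows, he]))
        (fun e he => hq e (by simp [arrows, he])) rfl)]

end QPath

/-- under the elimination-data hypotheses there is at most one
path between two given vertices all of whose arrows belong to `{f 0, …, f (l-1)}`. -/
theorem statement2 {P E : Type} [Fintype P] [Fintype E] (s t : E → P)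
    {l m : ℕ} (a : Fin l → P) (b : Fin m → P) (f : Fin l → E)
    (hab : Function.Bijective (Sum.elim a b))
    (hf : Function.Injective f)
    (hft : ∀ i, t (f i) = a i)
    (hfs : ∀ (i j : Fin l), s (f i) = a j → (i : ℕ) < (j : ℕ))
    {x y : P} (p q : QPath s t x y)
    (hp : ∀ e ∈ p.arrows, ∃ i, f i = e)
    (hq : ∀ e ∈ q.arrows, ∃ i, f i = e) :
    p = q := by
  have ha : Function.Injective a := hab.1.comp Sum.inl_injective
  exact eq_of_heq (QPath.heq_of_end_eq ha hft hfs p q hp hq rfl)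
end

section
/- Under the elimination-data hypotheses, the image ρ(IDer(C, D̂∘t)) of the space of inner derivations under the restriction map equals the subspace V̄ + W̄ of ⊕_{α arrow of Q} D̂(t(α)). -/
section Elim

variable (k : Type) [Field k] {P E : Type} (s t : E → P)
  (D : P → Type) [∀ x, AddCommGroup (D x)] [∀ x, Module k (D x)]
  (De : ∀ e : E, D (s e) →ₗ[k] D (t e))
  {l m n r : ℕ}

/-- A path is a `Q1`-path if all of its arrows belong to the range of `f`. -/
def IsQ1 (f : Fin l → E) {x y : P} (p : QPath s t x y) : Prop :=
  ∀ e ∈ p.arrows, ∃ i, f i = e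

open scoped Classical in
/-- The component at an arrow `e` (not in `Q1`) of the vectors `V_j(v)` and `W_j(v)`:
`D̂(p)(v) − D̂(e ∘ p')(v)` where `p` (resp. `p'`) is a `Q1`-path from `x` to `t e`
(resp. to `s e`), a missing term being `0`. -/
noncomputable def pathTerm (f : Fin l → E) (x : P) (e : E) (v : D x) : D (t e) :=
  (if hp : ∃ p : QPath s t x (t e), IsQ1 s t f p then
      pathMap k s t D De hp.choose v
    else 0)
  - (if hp : ∃ p : QPath s t x (s e), IsQ1 s t f p then
      De e (pathMap k s t D De hp.choose v)
    else 0)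

open scoped Classical in
/-- The vector `V_j(v)`. -/
noncomputable def Vvec (a : Fin l → P) (f : Fin l → E) (hft : ∀ i, t (f i) = a i)
    (j : Fin l) (v : D (a j)) : ∀ e : E, D (t e) := fun e =>
  if ∃ i, f i = e then
    (if he : f j = e then cast (show D (a j) = D (t e) by rw [← he, hft j]) v else 0)
  else pathTerm k s t D De f (a j) e v

open scoped Classical in
/-- The vector `W_j(v)`. -/
noncomputable def Wvec (b : Fin m → P) (f : Fin l → E)
    (j : Fin m) (v : D (b j)) : ∀ e : E, D (t e) := fun e =>
  if ∃ i, f i = e then 0 else pathTerm k s t D De f (b j) e v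

end Elim

section InnerDerivations

variable (k : Type) [Field k] {P E : Type} (s t : E → P)
  (D : P → Type) [∀ x, AddCommGroup (D x)] [∀ x, Module k (D x)]
  (De : ∀ e : E, D (s e) →ₗ[k] D (t e))

theorem pathMap_single (e : E) : pathMap k s t D De (QPath.single e) = De e := by
  rw [QPath.single, pathMap, pathMap, LinearMap.comp_id]

theorem pathMap_comp {x y z : P} (p : QPath s t x y) (q : QPath s t y z) :
    pathMap k s t D De (p.comp q) = (pathMap k s t D De q).comp (pathMap k s t D De p) := by
  induction q with
  | nil => rw [QPath.comp, pathMap, LinearMap.id_comp]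
  | cons e q ih => rw [QPath.comp, pathMap, ih, pathMap, LinearMap.comp_assoc]

/-- The values on arrows of the inner derivation attached to a family of vectors. -/
def innerOnArrows : (∀ x, D x) →ₗ[k] (∀ e : E, D (t e)) where
  toFun c e := De e (c (s e)) - c (t e)
  map_add' c c' := by
    funext e
    simp only [Pi.add_apply, map_add]
    abel
  map_smul' r c := by
    funext e
    simp only [Pi.smul_apply, map_smul, smul_sub, RingHom.id_apply]

theorem innerOnArrows_apply (c : ∀ x, D x) (e : E) :
    innerOnArrows k s t D De c e = De e (c (s e)) - c (t e) := rfl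

theorem map_restrict_IderInDer :
    Submodule.map (restrict k s t D De) (IderInDer k s t D De)
      = LinearMap.range (innerOnArrows k s t D De) := by
  ext w
  constructor
  · rintro ⟨d, ⟨c, hc⟩, rfl⟩
    exact ⟨c, funext fun e => by
      rw [innerOnArrows_apply, ← pathMap_single k s t D De e]
      exact (hc _ _ (QPath.single e)).symm⟩
  · rintro ⟨c, rfl⟩
    have hd : IsDerivation k s t D De
        (fun x y p => pathMap k s t D De p (c x) - c y) := by
      intro x y z p q
      simp only [pathMap_comp, LinearMap.comp_apply, map_sub]
      abel
    refine ⟨⟨_, hd⟩, ⟨c, fun _ _ _ => rfl⟩, funext fun e => ?_⟩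
    rw [innerOnArrows_apply, ← pathMap_single k s t D De e]
    rfl

end InnerDerivations

section Q1Paths

variable {P E : Type} {s t : E → P} {l : ℕ} {f : Fin l → E}

theorem isQ1_nil (x : P) : IsQ1 s t f (QPath.nil x) := by
  simp [IsQ1, QPath.arrows]

theorem isQ1_cons_iff {x : P} (e : E) (p : QPath s t x (s e)) :
    IsQ1 s t f (QPath.cons e p) ↔ (∃ i, f i = e) ∧ IsQ1 s t f p := by
  simp only [IsQ1, QPath.arrows, List.forall_mem_cons]

theorem IsQ1.rank_le {rk : P → ℕ} (hrk : ∀ i, rk (t (f i)) < rk (s (f i)))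
    {x y : P} {p : QPath s t x y} (hp : IsQ1 s t f p) : rk y ≤ rk x := by
  induction p with
  | nil => exact le_rfl
  | cons e p ih =>
    obtain ⟨⟨i, rfl⟩, hp⟩ := (isQ1_cons_iff e p).1 hp
    exact (hrk i).le.trans (ih hp)

theorem IsQ1.eq_or_rank_lt {rk : P → ℕ} (hrk : ∀ i, rk (t (f i)) < rk (s (f i)))
    {x y : P} {p : QPath s t x y} (hp : IsQ1 s t f p) : x = y ∨ rk y < rk x := by
  cases p with
  | nil => exact Or.inl rfl
  | cons e p =>
    obtain ⟨⟨i, rfl⟩, hp⟩ := (isQ1_cons_iff e p).1 hp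
    exact Or.inr ((hrk i).trans_le (hp.rank_le hrk))

theorem IsQ1.heq {rk : P → ℕ} (hrk : ∀ i, rk (t (f i)) < rk (s (f i)))
    (hinj : Function.Injective fun i => t (f i))
    {x y z : P} {p : QPath s t x y} {q : QPath s t x z} (hyz : y = z)
    (hp : IsQ1 s t f p) (hq : IsQ1 s t f q) : HEq p q := by
  induction p generalizing z with
  | nil =>
    cases q with
    | nil => rfl
    | cons e q =>
      obtain ⟨⟨i, rfl⟩, hq⟩ := (isQ1_cons_iff e q).1 hq
      have h₁ := hrk i
      have h₂ := hq.rank_le hrk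
      rw [← hyz] at h₁
      exact absurd h₁ h₂.not_gt
  | cons e p ih =>
    obtain ⟨⟨i, rfl⟩, hp⟩ := (isQ1_cons_iff e p).1 hp
    cases q with
    | nil =>
      have h₁ := hrk i
      have h₂ := hp.rank_le hrk
      rw [hyz] at h₁
      exact absurd h₁ h₂.not_gt
    | cons e' q =>
      obtain ⟨⟨j, rfl⟩, hq⟩ := (isQ1_cons_iff e' q).1 hq
      obtain rfl : i = j := hinj hyz
      rw [eq_of_heq (ih rfl hp hq)]

theorem IsQ1.exists_source {x z : P} {p : QPath s t x z}
    (hinj : Function.Injective fun i => t (f i)) (hp : IsQ1 s t f p) (hxz : x ≠ z)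
    {i : Fin l} (hi : t (f i) = z) : ∃ q : QPath s t x (s (f i)), IsQ1 s t f q := by
  cases p with
  | nil => exact absurd rfl hxz
  | cons e p =>
    obtain ⟨⟨j, rfl⟩, hp⟩ := (isQ1_cons_iff e p).1 hp
    obtain rfl : i = j := hinj hi
    exact ⟨p, hp⟩

end Q1Paths

section Transport

variable (k : Type) [Field k] {P E : Type} (s t : E → P)
  (D : P → Type) [∀ x, AddCommGroup (D x)] [∀ x, Module k (D x)]
  (De : ∀ e : E, D (s e) →ₗ[k] D (t e)) {l : ℕ} (f : Fin l → E)

open scoped Classical in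
/-- The family obtained by pushing `v : D x` forward along all `Q1`-paths starting at `x`. -/
noncomputable def q1Transport (x : P) (v : D x) : ∀ y, D y := fun y =>
  if hp : ∃ p : QPath s t x y, IsQ1 s t f p then pathMap k s t D De hp.choose v else 0

theorem pathTerm_eq (x : P) (v : D x) (e : E) :
    pathTerm k s t D De f x e v = -innerOnArrows k s t D De (q1Transport k s t D De f x v) e := by
  rw [innerOnArrows_apply, neg_sub, pathTerm, q1Transport, q1Transport]
  congr 1
  split_ifs <;> simp

variable {f} {rk : P → ℕ} (hrk : ∀ i, rk (t (f i)) < rk (s (f i)))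
  (hinj : Function.Injective fun i => t (f i))

include hrk hinj

theorem q1Transport_of_isQ1 {x y : P} (v : D x) {p : QPath s t x y} (hp : IsQ1 s t f p) :
    q1Transport k s t D De f x v y = pathMap k s t D De p v := by
  have h : ∃ p : QPath s t x y, IsQ1 s t f p := ⟨p, hp⟩
  rw [q1Transport, dif_pos h, eq_of_heq (h.choose_spec.heq hrk hinj rfl hp)]

theorem q1Transport_self (x : P) (v : D x) : q1Transport k s t D De f x v x = v := by
  rw [q1Transport_of_isQ1 k s t D De hrk hinj v (isQ1_nil x), pathMap, LinearMap.id_apply]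

omit hinj in
theorem q1Transport_eq_zero {x y : P} (v : D x) (hxy : x ≠ y) (hle : rk x ≤ rk y) :
    q1Transport k s t D De f x v y = 0 := by
  rw [q1Transport, dif_neg]
  rintro ⟨p, hp⟩
  exact (hp.eq_or_rank_lt hrk).elim hxy hle.not_gt

theorem q1Transport_target {x : P} (v : D x) (i : Fin l) (hx : x ≠ t (f i)) :
    q1Transport k s t D De f x v (t (f i))
      = De (f i) (q1Transport k s t D De f x v (s (f i))) := by
  by_cases h : ∃ p : QPath s t x (s (f i)), IsQ1 s t f p
  · obtain ⟨p, hp⟩ := h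
    rw [q1Transport_of_isQ1 k s t D De hrk hinj v hp,
      q1Transport_of_isQ1 k s t D De hrk hinj v ((isQ1_cons_iff (f i) p).2 ⟨⟨i, rfl⟩, hp⟩),
      pathMap, LinearMap.comp_apply]
  · rw [q1Transport, q1Transport, dif_neg h, dif_neg, map_zero]
    rintro ⟨p, hp⟩
    exact h (hp.exists_source hinj hx rfl)

omit hinj in
theorem q1Transport_source (i : Fin l) (v : D (t (f i))) :
    q1Transport k s t D De f (t (f i)) v (s (f i)) = 0 :=
  q1Transport_eq_zero k s t D De hrk v (fun h => (hrk i).ne (congrArg rk h)) (hrk i).le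

theorem Vvec_eq (a : Fin l → P) (hft : ∀ i, t (f i) = a i) (j : Fin l) (v : D (a j)) :
    Vvec k s t D De a f hft j v
      = -innerOnArrows k s t D De (q1Transport k s t D De f (a j) v) := by
  obtain rfl : (fun i => t (f i)) = a := funext hft
  funext e
  rw [Vvec, Pi.neg_apply]
  split_ifs with h he
  · subst he
    rw [innerOnArrows_apply, q1Transport_source k s t D De hrk,
      q1Transport_self k s t D De hrk hinj, map_zero, zero_sub, neg_neg]
    rfl
  · obtain ⟨i, rfl⟩ := h
    rw [innerOnArrows_apply, q1Transport_target k s t D De hrk hinj v i, sub_self, neg_zero]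
    exact fun h => he (congrArg f (hinj h))
  · exact pathTerm_eq k s t D De f _ v e

theorem Wvec_eq {m : ℕ} (b : Fin m → P) (hb : ∀ j i, b j ≠ t (f i)) (j : Fin m) (v : D (b j)) :
    Wvec k s t D De b f j v
      = -innerOnArrows k s t D De (q1Transport k s t D De f (b j) v) := by
  funext e
  rw [Wvec, Pi.neg_apply]
  split_ifs with h
  · obtain ⟨i, rfl⟩ := h
    rw [innerOnArrows_apply, q1Transport_target k s t D De hrk hinj v i (hb j i), sub_self,
      neg_zero]
  · exact pathTerm_eq k s t D De f _ v e

theorem eq_top_of_q1Transport_mem [Fintype P] (U : Submodule k (∀ x, D x))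
    (hU : ∀ x v, q1Transport k s t D De f x v ∈ U) : U = ⊤ := by
  classical
  have hsingle : ∀ r x, rk x = r → ∀ v : D x, Pi.single x v ∈ U := by
    intro r
    induction r using Nat.strong_induction_on with
    | _ r ih =>
      rintro x rfl v
      have hsum := Finset.univ_sum_single (q1Transport k s t D De f x v)
      rw [← Finset.add_sum_erase _ _ (Finset.mem_univ x),
        q1Transport_self k s t D De hrk hinj] at hsum
      rw [eq_sub_of_add_eq hsum]
      refine U.sub_mem (hU x v) (U.sum_mem fun y hy => ?_)
      rcases lt_or_ge (rk y) (rk x) with hlt | hle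
      · exact ih _ hlt y rfl _
      · rw [q1Transport_eq_zero k s t D De hrk v (Finset.ne_of_mem_erase hy).symm hle,
          Pi.single_zero]
        exact U.zero_mem
  rw [eq_top_iff]
  rintro c -
  rw [← Finset.univ_sum_single c]
  exact U.sum_mem fun x _ => hsingle _ x rfl _

end Transport

/-- under the elimination-data hypotheses, the image of the inner
derivations under `ρ` equals `V̄ + W̄`. -/
theorem statement3 (k : Type) [Field k] {P E : Type} [Fintype P] [Fintype E]
    (s t : E → P)
    (D : P → Type) [∀ x, AddCommGroup (D x)] [∀ x, Module k (D x)]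
    (De : ∀ e : E, D (s e) →ₗ[k] D (t e))
    {l m n r : ℕ} (a : Fin l → P) (b : Fin m → P)
    (f : Fin l → E) (g : Fin n → E) (h : Fin r → E)
    (hab : Function.Bijective (Sum.elim a b))
    (hfgh : Function.Bijective (Sum.elim f (Sum.elim g h)))
    (hft : ∀ i, t (f i) = a i)
    (hfs : ∀ (i j : Fin l), s (f i) = a j → (i : ℕ) < (j : ℕ)) :
    Submodule.map (restrict k s t D De) (IderInDer k s t D De)
      = Submodule.span k
          {w : ∀ e : E, D (t e) | ∃ (j : Fin l) (v : D (a j)), w = Vvec k s t D De a f hft j v}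
        + Submodule.span k
          {w : ∀ e : E, D (t e) | ∃ (j : Fin m) (v : D (b j)), w = Wvec k s t D De b f j v} := by
  have hinj : Function.Injective fun i => t (f i) := by
    simp only [hft]
    exact hab.1.comp Sum.inl_injective
  obtain ⟨rk, hrk⟩ : ∃ rk : P → ℕ, ∀ i, rk (t (f i)) < rk (s (f i)) := by
    let φ := Equiv.ofBijective _ hab
    refine ⟨fun x => Sum.elim (fun j : Fin l => (j : ℕ)) (fun _ : Fin m => l) (φ.symm x),
      fun i => ?_⟩
    have ht : φ.symm (t (f i)) = Sum.inl i := φ.symm_apply_eq.2 (hft i)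
    simp only [ht, Sum.elim_inl]
    rcases hs : φ.symm (s (f i)) with j | j
    · exact hfs i j (φ.symm_apply_eq.1 hs)
    · exact i.isLt
  have hb : ∀ j i, b j ≠ t (f i) := fun j i hji =>
    Sum.inr_ne_inl (hab.1 (hji.trans (hft i) : Sum.elim a b (Sum.inr j) = Sum.elim a b (Sum.inl i)))
  have hV := Vvec_eq k s t D De hrk hinj a hft
  have hW := Wvec_eq k s t D De hrk hinj b hb
  rw [map_restrict_IderInDer, Submodule.add_eq_sup]
  apply le_antisymm
  · rw [LinearMap.range_le_iff_comap]
    refine eq_top_of_q1Transport_mem k s t D De hrk hinj _ fun x v => ?_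
    rw [Submodule.mem_comap, ← Submodule.neg_mem_iff]
    obtain ⟨j | j, rfl⟩ := hab.2 x
    · exact Submodule.mem_sup_left (Submodule.subset_span ⟨j, v, (hV j v).symm⟩)
    · exact Submodule.mem_sup_right (Submodule.subset_span ⟨j, v, (hW j v).symm⟩)
  · rw [sup_le_iff, Submodule.span_le, Submodule.span_le]
    constructor
    · rintro _ ⟨j, v, rfl⟩
      rw [hV]
      exact Submodule.neg_mem _ (LinearMap.mem_range_self _ _)
    · rintro _ ⟨j, v, rfl⟩
      rw [hW]
      exact Submodule.neg_mem _ (LinearMap.mem_range_self _ _)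
end

section
/- Let Q be the chain quiver with vertices 1, …, n and arrows α_i : i+1 → i for 1 ≤ i ≤ n−1. Then every derivation of C with coefficients in D̂∘t is inner; in particular H¹_BW(C, D̂∘t) = 0 for every functor D̂ from C to k-vector spaces. -/
/-- Source map of the chain quiver: the arrow `α_i : i+1 → i`. -/
def chainS (n : ℕ) (e : Fin (n - 1)) : Fin n := ⟨(e : ℕ) + 1, by have := e.isLt; omega⟩

/-- Target map of the chain quiver. -/
def chainT (n : ℕ) (e : Fin (n - 1)) : Fin n := ⟨(e : ℕ), by have := e.isLt; omega⟩

/-- A derivation that agrees on the arrows with the inner derivation of `nn` is that inner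
derivation. -/
theorem IsDerivation.eq_of_arrows {k : Type} [Field k] {P E : Type} {s t : E → P}
    {D : P → Type} [∀ x, AddCommGroup (D x)] [∀ x, Module k (D x)]
    {De : ∀ e : E, D (s e) →ₗ[k] D (t e)} {d : ∀ x y : P, QPath s t x y → D y}
    (hd : IsDerivation k s t D De d) (nn : ∀ x : P, D x)
    (h : ∀ e, d (s e) (t e) (QPath.single e) = De e (nn (s e)) - nn (t e))
    (x y : P) (p : QPath s t x y) :
    d x y p = pathMap k s t D De p (nn x) - nn y := by
  induction p with
  | nil =>
    have h0 := hd x x x (.nil x) (.nil x)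
    simpa [pathMap, QPath.comp] using h0
  | cons e p ih =>
    have h1 := hd x (s e) (t e) p (QPath.single e)
    simp only [QPath.single, QPath.comp, pathMap, LinearMap.comp_id] at h1 h
    rw [h1, ih, h e, map_sub]
    simp [pathMap]

/-- On the chain quiver, every family of values on the arrows comes from an inner derivation. -/
theorem exists_inner_on_chain_arrows {k : Type} [Field k] (n : ℕ)
    (D : Fin n → Type) [∀ x, AddCommGroup (D x)] [∀ x, Module k (D x)]
    (De : ∀ e : Fin (n - 1), D (chainS n e) →ₗ[k] D (chainT n e))
    (a : ∀ e : Fin (n - 1), D (chainT n e)) :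
    ∃ nn : ∀ x, D x, ∀ e, a e = De e (nn (chainS n e)) - nn (chainT n e) := by
  cases n with
  | zero => exact ⟨fun x => x.elim0, fun e => e.elim0⟩
  | succ m =>
    let step : ∀ i : Fin m, D i.succ → D i.castSucc := fun i v => De i v - a i
    let nn : ∀ x, D x := fun x => Fin.reverseInduction (motive := D) 0 step x
    refine ⟨nn, fun e => ?_⟩
    have h : nn (chainT (m + 1) e) = De e (nn (chainS (m + 1) e)) - a e :=
      Fin.reverseInduction_castSucc (motive := D) (zero := 0) (succ := step) e
    rw [h, sub_sub_cancel]

/-- for the chain quiver every derivation is inner; in particular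
the first Baues–Wirsching cohomology vanishes for every coefficient functor. -/
theorem statement5 (k : Type) [Field k] (n : ℕ)
    (D : Fin n → Type) [∀ x, AddCommGroup (D x)] [∀ x, Module k (D x)]
    (De : ∀ e : Fin (n - 1), D (chainS n e) →ₗ[k] D (chainT n e)) :
    Der k (chainS n) (chainT n) D De ≤ Ider k (chainS n) (chainT n) D De
    ∧ Subsingleton (BW1 k (chainS n) (chainT n) D De) := by
  have hle : Der k (chainS n) (chainT n) D De ≤ Ider k (chainS n) (chainT n) D De := by
    intro d hd
    obtain ⟨nn, hnn⟩ := exists_inner_on_chain_arrows n D De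
      (fun e => d (chainS n e) (chainT n e) (QPath.single e))
    exact ⟨nn, IsDerivation.eq_of_arrows hd nn hnn⟩
  refine ⟨hle, Submodule.Quotient.subsingleton_iff.mpr ?_⟩
  exact eq_top_iff.mpr fun d _ => hle d.2
end

section
/- Let Q be the zigzag-circle quiver with vertices x_j, y_j for j ∈ ℤ/nℤ and arrows α_j : y_j → x_j and β_j : y_{j−1} → x_j for j ∈ ℤ/nℤ, and let D̂ = π_C(kC) be the regular-module coefficient functor. Then H¹_BW(C, D̂∘t) is isomorphic as a k-vector space to ⊕_{j∈ℤ/nℤ} span_k{id_{x_j}, α_j} (a subspace of ⊕_j D̂(x_j)); in particular dim_k H¹_BW(C, D̂∘t) = 2n. -/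
section Reg

variable (k : Type) [Field k] {P E : Type} (s t : E → P)

/-- The regular-module coefficient functor on vertices: the free `k`-vector space
on the set of paths with target `x`. -/
abbrev RegMod (x : P) : Type := (Σ y : P, QPath s t y x) →₀ k

/-- The regular-module coefficient functor on arrows: concatenation with `e`. -/
noncomputable def regMap (e : E) : RegMod k s t (s e) →ₗ[k] RegMod k s t (t e) :=
  Finsupp.lmapDomain k k (fun q => ⟨q.1, QPath.cons e q.2⟩)

end Reg

/-- Source map of the zigzag-circle quiver: vertices are `Sum.inl j = x_j` and
`Sum.inr j = y_j`; arrows are `Sum.inl j = α_j : y_j → x_j` and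
`Sum.inr j = β_j : y_{j-1} → x_j`. -/
def zzS (n : ℕ) : ZMod n ⊕ ZMod n → ZMod n ⊕ ZMod n
  | Sum.inl j => Sum.inr j
  | Sum.inr j => Sum.inr (j - 1)

/-- Target map of the zigzag-circle quiver. -/
def zzT (n : ℕ) : ZMod n ⊕ ZMod n → ZMod n ⊕ ZMod n
  | Sum.inl j => Sum.inl j
  | Sum.inr j => Sum.inl j

section Derivations

variable {k : Type} [Field k] {P E : Type} {s t : E → P}
  {D : P → Type} [∀ x, AddCommGroup (D x)] [∀ x, Module k (D x)]
  {De : ∀ e : E, D (s e) →ₗ[k] D (t e)}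

theorem IsDerivation.map_nil {d : ∀ x y : P, QPath s t x y → D y}
    (hd : IsDerivation k s t D De d) (x : P) : d x x (.nil x) = 0 := by
  have h := hd x x x (.nil x) (.nil x)
  simpa [QPath.comp, pathMap] using h

theorem IsDerivation.map_cons {d : ∀ x y : P, QPath s t x y → D y}
    (hd : IsDerivation k s t D De d) {x : P} (e : E) (p : QPath s t x (s e)) :
    d x (t e) (.cons e p) = De e (d x (s e) p) + d (s e) (t e) (.single e) := by
  have h := hd x (s e) (t e) p (.single e)
  simpa [QPath.comp, QPath.single, pathMap] using h

/-- A derivation is inner as soon as it is so on arrows. -/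
theorem mem_IderInDer_iff (d : ↥(Der k s t D De)) :
    d ∈ IderInDer k s t D De ↔ ∃ nn : ∀ x : P, D x, ∀ e : E,
      restrict k s t D De d e = De e (nn (s e)) - nn (t e) := by
  constructor
  · rintro ⟨nn, h⟩
    exact ⟨nn, fun e => by
      simpa [pathMap, QPath.single, restrict] using h (s e) (t e) (.single e)⟩
  · rintro ⟨nn, h⟩
    refine ⟨nn, fun x y p => ?_⟩
    have hd : IsDerivation k s t D De d.1 := d.2
    induction p with
    | nil => simp [hd.map_nil, pathMap]
    | cons e p ih =>
      have he : d.1 (s e) (t e) (.single e) = _ := h e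
      rw [Submodule.subtype_apply] at ih ⊢
      rw [hd.map_cons, ih, he]
      simp [pathMap]

variable (k s t D De) in
/-- The extension to all paths of a function given on arrows, by the Leibniz rule. -/
def derivationExtend (φ : ∀ e : E, D (t e)) : ∀ x y : P, QPath s t x y → D y
  | _, _, .nil _ => 0
  | _, _, .cons e p => De e (derivationExtend φ _ _ p) + φ e

theorem isDerivation_derivationExtend (φ : ∀ e : E, D (t e)) :
    IsDerivation k s t D De (derivationExtend k s t D De φ) := by
  intro x y z p q
  induction q with
  | nil => simp [QPath.comp, pathMap, derivationExtend]
  | cons e q ih => simp [QPath.comp, pathMap, derivationExtend, ih, add_assoc]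

theorem restrict_surjective : Function.Surjective (restrict k s t D De) := fun φ =>
  ⟨⟨derivationExtend k s t D De φ, isDerivation_derivationExtend φ⟩, by
    ext e
    simp [restrict, QPath.single, derivationExtend]⟩

end Derivations

section Zigzag

variable {n : ℕ}

/-- The identity path at `x_j`. -/
abbrev zzId (j : ZMod n) : Σ y, QPath (zzS n) (zzT n) y (Sum.inl j) :=
  ⟨Sum.inl j, QPath.nil (Sum.inl j)⟩

/-- The path `α_j`. -/
abbrev zzAlpha (j : ZMod n) : Σ y, QPath (zzS n) (zzT n) y (Sum.inl j) :=
  ⟨Sum.inr j, QPath.single (Sum.inl j)⟩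

/-- The path `β_j`. -/
abbrev zzBeta (j : ZMod n) : Σ y, QPath (zzS n) (zzT n) y (Sum.inl j) :=
  ⟨Sum.inr (j - 1), QPath.single (Sum.inr j)⟩

/-- The identity path at `y_j`. -/
abbrev zzIdY (j : ZMod n) : Σ y, QPath (zzS n) (zzT n) y (Sum.inr j) :=
  ⟨Sum.inr j, QPath.nil (Sum.inr j)⟩

theorem QPath.arrows_single {P E : Type} {s t : E → P} (e : E) :
    (QPath.single e : QPath s t (s e) (t e)).arrows = [e] := by
  simp [QPath.single, QPath.arrows]

theorem QPath.arrows_nil {P E : Type} {s t : E → P} (x : P) :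
    (QPath.nil x : QPath s t x x).arrows = [] := by
  simp [QPath.arrows]

theorem zzAlpha_ne_zzId (j : ZMod n) : zzAlpha j ≠ zzId j := fun h => by
  have : ([Sum.inl j] : List (ZMod n ⊕ ZMod n)) = [] :=
    (QPath.arrows_single (Sum.inl j)).symm.trans
      ((congrArg (fun q => q.2.arrows) h).trans (QPath.arrows_nil (Sum.inl j)))
  simp at this

theorem zzBeta_ne_zzId (j : ZMod n) : zzBeta j ≠ zzId j := fun h => by
  have : ([Sum.inr j] : List (ZMod n ⊕ ZMod n)) = [] :=
    (QPath.arrows_single (Sum.inr j)).symm.trans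
      ((congrArg (fun q => q.2.arrows) h).trans (QPath.arrows_nil (Sum.inl j)))
  simp at this

theorem zzBeta_ne_zzAlpha (j : ZMod n) : zzBeta j ≠ zzAlpha j := fun h => by
  have : ([Sum.inr j] : List (ZMod n ⊕ ZMod n)) = [Sum.inl j] :=
    (QPath.arrows_single (Sum.inr j)).symm.trans
      ((congrArg (fun q => q.2.arrows) h).trans (QPath.arrows_single (Sum.inl j)))
  simp at this

/-- The list of all paths with a given target. -/
def zzPaths : ∀ v : ZMod n ⊕ ZMod n, List (Σ y, QPath (zzS n) (zzT n) y v)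
  | Sum.inl j => [zzId j, zzAlpha j, zzBeta j]
  | Sum.inr j => [zzIdY j]

theorem mem_zzPaths {x v : ZMod n ⊕ ZMod n} (p : QPath (zzS n) (zzT n) x v) :
    (⟨x, p⟩ : Σ y, QPath (zzS n) (zzT n) y v) ∈ zzPaths v := by
  induction p with
  | nil => cases x <;> simp [zzPaths]
  | cons e p ih =>
    rcases e with j | j
    · have h := congrArg (fun q : Σ y, QPath (zzS n) (zzT n) y (zzS n (Sum.inl j)) =>
        (⟨q.1, .cons (Sum.inl j) q.2⟩ : Σ y, QPath (zzS n) (zzT n) y (Sum.inl j)))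
        (List.mem_singleton.mp ih)
      exact List.mem_cons_of_mem _ (List.mem_cons.mpr (Or.inl h))
    · have h := congrArg (fun q : Σ y, QPath (zzS n) (zzT n) y (zzS n (Sum.inr j)) =>
        (⟨q.1, .cons (Sum.inr j) q.2⟩ : Σ y, QPath (zzS n) (zzT n) y (Sum.inl j)))
        (List.mem_singleton.mp ih)
      exact List.mem_cons_of_mem _ (List.mem_cons_of_mem _ (List.mem_singleton.mpr h))

variable {k : Type} [Field k]

theorem regMod_inl_ext {j : ZMod n} {f g : RegMod k (zzS n) (zzT n) (Sum.inl j)}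
    (hid : f (zzId j) = g (zzId j)) (hα : f (zzAlpha j) = g (zzAlpha j))
    (hβ : f (zzBeta j) = g (zzBeta j)) : f = g := by
  ext ⟨y, p⟩
  have h := mem_zzPaths p
  simp only [zzPaths, List.mem_cons, List.not_mem_nil, or_false] at h
  rcases h with h | h | h <;> rw [h] <;> assumption

theorem regMod_inr_eq_single {j : ZMod n} (f : RegMod k (zzS n) (zzT n) (Sum.inr j)) :
    f = Finsupp.single (zzIdY j) (f (zzIdY j)) := by
  ext ⟨y, p⟩
  rw [List.mem_singleton.mp (mem_zzPaths p), Finsupp.single_eq_same]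

theorem regMap_alpha_single (j : ZMod n) (c : k) :
    regMap k (zzS n) (zzT n) (Sum.inl j) (Finsupp.single (zzIdY j) c) =
      Finsupp.single (zzAlpha j) c :=
  Finsupp.mapDomain_single

theorem regMap_beta_single (j : ZMod n) (c : k) :
    regMap k (zzS n) (zzT n) (Sum.inr j) (Finsupp.single (zzIdY (j - 1)) c) =
      Finsupp.single (zzBeta j) c :=
  Finsupp.mapDomain_single

theorem regMap_alpha (j : ZMod n) (f : RegMod k (zzS n) (zzT n) (Sum.inr j)) :
    regMap k (zzS n) (zzT n) (Sum.inl j) f = Finsupp.single (zzAlpha j) (f (zzIdY j)) := by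
  conv_lhs => rw [regMod_inr_eq_single f]
  exact regMap_alpha_single j _

theorem regMap_beta (j : ZMod n) (f : RegMod k (zzS n) (zzT n) (Sum.inr (j - 1))) :
    regMap k (zzS n) (zzT n) (Sum.inr j) f =
      Finsupp.single (zzBeta j) (f (zzIdY (j - 1))) := by
  conv_lhs => rw [regMod_inr_eq_single f]
  exact regMap_beta_single j _

variable (n k) in
/-- The difference of the values on `α_j` and `β_j`. -/
noncomputable def zzDiff (j : ZMod n) : (∀ e, RegMod k (zzS n) (zzT n) (zzT n e)) →ₗ[k]
    RegMod k (zzS n) (zzT n) (Sum.inl j) where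
  toFun φ := (show RegMod k (zzS n) (zzT n) (Sum.inl j) from φ (Sum.inl j)) -
    (show RegMod k (zzS n) (zzT n) (Sum.inl j) from φ (Sum.inr j))
  map_add' _ _ := add_sub_add_comm _ _ _ _
  map_smul' c _ := (smul_sub c _ _).symm

variable (n k) in
/-- The coordinates of the cohomology class of a derivation given by its values on arrows. -/
noncomputable def zzCoords :
    (∀ e, RegMod k (zzS n) (zzT n) (zzT n e)) →ₗ[k] (ZMod n → k × k) :=
  LinearMap.pi fun j => LinearMap.prod
    (Finsupp.lapply (zzId j) ∘ₗ zzDiff n k j)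
    (Finsupp.lapply (zzAlpha (j - 1)) ∘ₗ zzDiff n k (j - 1) +
      Finsupp.lapply (zzBeta j) ∘ₗ zzDiff n k j)

theorem zzCoords_apply (φ : ∀ e, RegMod k (zzS n) (zzT n) (zzT n e)) (j : ZMod n) :
    zzCoords n k φ j = (zzDiff n k j φ (zzId j),
      zzDiff n k (j - 1) φ (zzAlpha (j - 1)) + zzDiff n k j φ (zzBeta j)) := rfl

theorem zzCoords_surjective : Function.Surjective (zzCoords n k) := by
  intro g
  let φ : ∀ e, RegMod k (zzS n) (zzT n) (zzT n e)
    | Sum.inl j => (Finsupp.single (zzId j) (g j).1 + Finsupp.single (zzBeta j) (g j).2 :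
        RegMod k (zzS n) (zzT n) (Sum.inl j))
    | Sum.inr j => (0 : RegMod k (zzS n) (zzT n) (Sum.inl j))
  have hφ (j : ZMod n) : zzDiff n k j φ =
      Finsupp.single (zzId j) (g j).1 + Finsupp.single (zzBeta j) (g j).2 := sub_zero _
  refine ⟨φ, funext fun j => ?_⟩
  rw [zzCoords_apply, hφ, hφ]
  simp only [Finsupp.add_apply, Finsupp.single_eq_same,
    Finsupp.single_eq_of_ne (zzAlpha_ne_zzId _), Finsupp.single_eq_of_ne (zzBeta_ne_zzId _),
    Finsupp.single_eq_of_ne (zzBeta_ne_zzId _).symm,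
    Finsupp.single_eq_of_ne (zzBeta_ne_zzAlpha _).symm, add_zero, zero_add]

theorem zzCoords_eq_zero_iff (φ : ∀ e, RegMod k (zzS n) (zzT n) (zzT n e)) :
    zzCoords n k φ = 0 ↔ ∃ nn : ∀ x, RegMod k (zzS n) (zzT n) x, ∀ e,
      φ e = regMap k (zzS n) (zzT n) e (nn (zzS n e)) - nn (zzT n e) := by
  constructor
  · intro h
    have h1 (j : ZMod n) : zzDiff n k j φ (zzId j) = 0 := congrArg Prod.fst (congrFun h j)
    have h2 (j : ZMod n) :
        zzDiff n k (j - 1) φ (zzAlpha (j - 1)) + zzDiff n k j φ (zzBeta j) = 0 :=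
      congrArg Prod.snd (congrFun h j)
    let c (j : ZMod n) : k := zzDiff n k j φ (zzAlpha j)
    let a (j : ZMod n) : RegMod k (zzS n) (zzT n) (Sum.inl j) := φ (Sum.inl j)
    let b (j : ZMod n) : RegMod k (zzS n) (zzT n) (Sum.inl j) := φ (Sum.inr j)
    have hab (j : ZMod n) : zzDiff n k j φ = a j - b j := rfl
    let nn : ∀ x, RegMod k (zzS n) (zzT n) x
      | Sum.inl j => Finsupp.single (zzAlpha j) (c j) - a j
      | Sum.inr j => Finsupp.single (zzIdY j) (c j)
    refine ⟨nn, ?_⟩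
    rintro (j | j)
    · have key : a j = Finsupp.single (zzAlpha j) (c j) -
          (Finsupp.single (zzAlpha j) (c j) - a j) := (sub_sub_cancel _ _).symm
      exact key.trans (congrArg (fun u : RegMod k (zzS n) (zzT n) (Sum.inl j) =>
        u - (Finsupp.single (zzAlpha j) (c j) - a j)) (regMap_alpha_single j (c j)).symm)
    · suffices key : b j = Finsupp.single (zzBeta j) (c (j - 1)) -
          (Finsupp.single (zzAlpha j) (c j) - a j) from
        key.trans (congrArg (fun u : RegMod k (zzS n) (zzT n) (Sum.inl j) =>
          u - (Finsupp.single (zzAlpha j) (c j) - a j)) (regMap_beta_single j (c (j - 1))).symm)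
      have h1j := h1 j
      have h2j : c (j - 1) + zzDiff n k j φ (zzBeta j) = 0 := h2 j
      have hc : c j = a j (zzAlpha j) - b j (zzAlpha j) := rfl
      rw [hab, Finsupp.sub_apply] at h1j h2j
      apply regMod_inl_ext <;>
      simp only [Finsupp.sub_apply, Finsupp.single_eq_same,
        Finsupp.single_eq_of_ne (zzAlpha_ne_zzId _).symm,
        Finsupp.single_eq_of_ne (zzBeta_ne_zzId _).symm,
        Finsupp.single_eq_of_ne (zzBeta_ne_zzAlpha _),
        Finsupp.single_eq_of_ne (zzBeta_ne_zzAlpha _).symm]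
      · linear_combination -h1j
      · linear_combination hc
      · linear_combination -h2j
  · rintro ⟨nn, h⟩
    have hd (j : ZMod n) : zzDiff n k j φ =
        Finsupp.single (zzAlpha j) (nn (Sum.inr j) (zzIdY j)) -
          Finsupp.single (zzBeta j) (nn (Sum.inr (j - 1)) (zzIdY (j - 1))) := by
      rw [← regMap_alpha, ← regMap_beta]
      refine (congrArg₂ (fun u v : RegMod k (zzS n) (zzT n) (Sum.inl j) => u - v)
        (h (Sum.inl j)) (h (Sum.inr j))).trans ?_
      exact sub_sub_sub_cancel_right _ _ _
    funext j
    rw [zzCoords_apply, hd, hd]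
    simp [Finsupp.sub_apply, Finsupp.single_eq_same,
      Finsupp.single_eq_of_ne (zzAlpha_ne_zzId _).symm,
      Finsupp.single_eq_of_ne (zzBeta_ne_zzId _).symm,
      Finsupp.single_eq_of_ne (zzBeta_ne_zzAlpha _),
      Finsupp.single_eq_of_ne (zzBeta_ne_zzAlpha _).symm]

variable (n k) in
/-- The cohomology of the zigzag circle in coordinates. -/
noncomputable def zzBW1Equiv : BW1 k (zzS n) (zzT n) (RegMod k (zzS n) (zzT n))
    (regMap k (zzS n) (zzT n)) ≃ₗ[k] (ZMod n → k × k) :=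
  (Submodule.quotEquivOfEq _ _ (by
    ext d
    rw [mem_IderInDer_iff, LinearMap.mem_ker, LinearMap.comp_apply, zzCoords_eq_zero_iff])).trans
  ((zzCoords n k ∘ₗ restrict k (zzS n) (zzT n) (RegMod k (zzS n) (zzT n))
    (regMap k (zzS n) (zzT n))).quotKerEquivOfSurjective
      (zzCoords_surjective.comp restrict_surjective))

end Zigzag

/-- The span of two distinct basis vectors of a free module is free of rank two. -/
theorem nonempty_span_pair_single_equiv (k : Type*) [Field k] {ι : Type*} {a b : ι}
    (hab : a ≠ b) : Nonempty ((k × k) ≃ₗ[k] ↥(Submodule.span k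
      ({Finsupp.single a (1 : k), Finsupp.single b (1 : k)} : Set (ι →₀ k)))) := by
  have hli : LinearIndependent k ![Finsupp.single a (1 : k), Finsupp.single b (1 : k)] := by
    rw [LinearIndependent.pair_iff]
    intro u v h
    have ha := DFunLike.congr_fun h a
    have hb := DFunLike.congr_fun h b
    simpa [Finsupp.single_eq_of_ne hab, Finsupp.single_eq_of_ne hab.symm] using And.intro ha hb
  exact ⟨((LinearEquiv.finTwoArrow k k).symm.trans (Module.Basis.span hli).equivFun.symm).trans
    (LinearEquiv.ofEq _ _ (by rw [Matrix.range_cons_cons_empty]))⟩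

/-- the first Baues–Wirsching cohomology of the zigzag-circle quiver
with regular-module coefficients, and its dimension `2n`. -/
theorem statement9 (k : Type) [Field k] (n : ℕ) (hn : 0 < n) :
    Nonempty (BW1 k (zzS n) (zzT n)
        (RegMod k (zzS n) (zzT n)) (regMap k (zzS n) (zzT n)) ≃ₗ[k]
      (∀ j : ZMod n, ↥(Submodule.span k
        ({Finsupp.single ⟨Sum.inl j, QPath.nil (Sum.inl j)⟩ (1 : k),
          Finsupp.single ⟨Sum.inr j, QPath.single (Sum.inl j)⟩ (1 : k)} :
          Set (RegMod k (zzS n) (zzT n) (Sum.inl j))))))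
    ∧ Module.finrank k (BW1 k (zzS n) (zzT n)
        (RegMod k (zzS n) (zzT n)) (regMap k (zzS n) (zzT n))) = 2 * n := by
  have : NeZero n := ⟨hn.ne'⟩
  constructor
  · exact ⟨(zzBW1Equiv n k).trans (LinearEquiv.piCongrRight fun j =>
      (nonempty_span_pair_single_equiv k (zzAlpha_ne_zzId j).symm).some)⟩
  · rw [(zzBW1Equiv n k).finrank_eq, Module.finrank_pi_fintype]
    simp [ZMod.card, mul_comm]
end
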